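/- arXiv:1402.0668 — 3 statements merged into one kernel-verified Lean document; each statement's English description precedes it below -/
import Mathlib

section
/- For every positive integer k there exist positive real constants α(k) and β(k) such that for all integers n ≥ k, α(k)·(n-1)!·(ln n)^{k-1} < [n, k] < β(k)·(n-1)!·(ln n)^{k-1}, where [n, k] denotes the unsigned Stirling number of the first kind, i.e., the number of permutations of [n] with exactly k cycles. -/
/-- The set of cycles of a permutation `π` of `Fin n`: a cycle is encoded as a pair
`(S, f)` consisting of a `π`-orbit `S` together with the function agreeing with `π`
on `S` and with the identity off `S`.  Fixed points count as 1-cycles. -/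
def Equiv.Perm.cycleSet {n : ℕ} (π : Equiv.Perm (Fin n)) :
    Set (Finset (Fin n) × (Fin n → Fin n)) :=
  {c | (∃ a, ∀ x, x ∈ c.1 ↔ π.SameCycle a x) ∧
    c.2 = fun x => if x ∈ c.1 then π x else x}

/-- The number of cycles (orbits) of a permutation of `Fin n`, counting fixed points
as 1-cycles. -/
noncomputable def Equiv.Perm.numCycles {n : ℕ} (π : Equiv.Perm (Fin n)) : ℕ :=
  π.cycleSet.ncard

/-- The unsigned Stirling number of the first kind `[n, k]`: the number of
permutations of an `n`-element set with exactly `k` cycles. -/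
noncomputable def stirlingFirst (n k : ℕ) : ℕ :=
  Nat.card {π : Equiv.Perm (Fin n) // π.numCycles = k}

namespace Equiv.Perm

/-- A function invariant under a permutation is constant on its cycles. -/
theorem SameCycle.apply_eq_of_invariant {α β : Type*} {π : Perm α} {f : α → β}
    (hf : ∀ x, f (π x) = f x) {x y : α} (h : π.SameCycle x y) : f x = f y := by
  obtain ⟨i, rfl⟩ := h
  induction i with
  | zero => simp
  | succ i ih => rw [add_comm, zpow_add, mul_apply, zpow_one, hf, ih]
  | pred i ih =>
    rw [ih, ← hf ((π ^ (-(i : ℤ) - 1)) x), ← mul_apply, ← zpow_one_add]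
    congr 3
    ring

/-- The quotient of the ground set by the orbit relation of a permutation. -/
abbrev CycleQuotient {α : Type*} (π : Perm α) : Type _ := Quotient (SameCycle.setoid π)

theorem CycleQuotient.mk_apply {α : Type*} (π : Perm α) (x : α) :
    (Quotient.mk _ (π x) : π.CycleQuotient) = Quotient.mk _ x :=
  Quotient.sound (sameCycle_apply_left.2 (SameCycle.refl π x))

theorem numCycles_eq_card_cycleQuotient {n : ℕ} (π : Perm (Fin n)) :
    π.numCycles = Nat.card π.CycleQuotient := by
  classical
  let S : Fin n → Finset (Fin n) := fun a => Finset.univ.filter (π.SameCycle a)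
  have hS : ∀ a x, x ∈ S a ↔ π.SameCycle a x := fun a x => by simp [S]
  have hwd : ∀ a b, π.SameCycle a b → S a = S b := fun a b hab => by
    ext x
    rw [hS, hS]
    exact ⟨hab.symm.trans, hab.trans⟩
  let F : π.CycleQuotient → Finset (Fin n) × (Fin n → Fin n) :=
    Quotient.lift (fun a => (S a, fun x => if x ∈ S a then π x else x))
      (fun a b hab => by simp only [hwd a b hab])
  have hinj : Function.Injective F := by
    intro q r
    induction q using Quotient.inductionOn with | _ a
    induction r using Quotient.inductionOn with | _ b
    intro h
    have h1 : S a = S b := congrArg Prod.fst h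
    exact Quotient.sound ((hS a b).1 (h1 ▸ (hS b b).2 (SameCycle.refl π b)))
  have hrange : π.cycleSet = Set.range F := by
    ext ⟨T, g⟩
    constructor
    · rintro ⟨⟨a, ha⟩, hg⟩
      have hT : T = S a := by
        ext x
        rw [hS]
        exact ha x
      refine ⟨Quotient.mk _ a, Prod.ext hT.symm ?_⟩
      simp only at hg
      subst hT
      rw [hg]
      rfl
    · rintro ⟨q, hq⟩
      induction q using Quotient.inductionOn with | _ a
      rw [← hq]
      exact ⟨⟨a, hS a⟩, rfl⟩
  rw [numCycles, hrange, ← Nat.card_coe_set_eq, Nat.card_range_of_injective hinj]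

/-- Inserting a new point into an existing cycle does not change the set of cycles. -/
theorem numCycles_decomposeFin_symm_succ {n : ℕ} (p : Fin n) (e : Perm (Fin n)) :
    (decomposeFin.symm (p.succ, e)).numCycles = e.numCycles := by
  rw [numCycles_eq_card_cycleQuotient, numCycles_eq_card_cycleQuotient]
  set τ := decomposeFin.symm (p.succ, e) with hτ
  have h0 : τ 0 = p.succ := decomposeFin_symm_apply_zero _ _
  have hs : ∀ x, τ x.succ = if e x = p then 0 else (e x).succ := fun x => by
    rw [hτ, decomposeFin_symm_apply_succ]
    split_ifs with h
    · rw [h, swap_apply_right]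
    · exact swap_apply_of_ne_of_ne (Fin.succ_ne_zero _) (fun h' => h (Fin.succ_injective _ h'))
  have hτ0 : (Quotient.mk _ p.succ : τ.CycleQuotient) = Quotient.mk _ 0 := by
    rw [← h0, CycleQuotient.mk_apply]
  let f : τ.CycleQuotient → e.CycleQuotient :=
    Quotient.lift (Fin.cases (Quotient.mk _ p) (fun x => Quotient.mk _ x))
      (fun a b hab => SameCycle.apply_eq_of_invariant (π := τ) (fun x => by
        induction x using Fin.cases with
        | zero => rw [h0]; rfl
        | succ x =>
          rw [hs]
          split_ifs with h
          · exact h ▸ CycleQuotient.mk_apply e x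
          · exact CycleQuotient.mk_apply e x) hab)
  let g : e.CycleQuotient → τ.CycleQuotient :=
    Quotient.lift (fun x => Quotient.mk _ x.succ)
      (fun a b hab => SameCycle.apply_eq_of_invariant (π := e)
        (f := fun x => (Quotient.mk _ x.succ : τ.CycleQuotient)) (fun x => by
          have h1 := CycleQuotient.mk_apply τ x.succ
          rw [hs] at h1
          split_ifs at h1 with h
          · simp only [h]
            rw [hτ0, h1]
          · exact h1) hab)
  refine Nat.card_congr ⟨f, g, fun q => ?_, fun q => ?_⟩
  · induction q using Quotient.inductionOn with | _ a
    induction a using Fin.cases with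
    | zero => exact hτ0
    | succ x => rfl
  · induction q using Quotient.inductionOn with | _ a
    rfl

/-- Adding a new fixed point increases the number of cycles by one. -/
theorem numCycles_decomposeFin_symm_zero {n : ℕ} (e : Perm (Fin n)) :
    (decomposeFin.symm (0, e)).numCycles = e.numCycles + 1 := by
  rw [numCycles_eq_card_cycleQuotient, numCycles_eq_card_cycleQuotient, ← Finite.card_option]
  set τ := decomposeFin.symm (0, e) with hτ
  have h0 : τ 0 = 0 := decomposeFin_symm_apply_zero _ _
  have hs : ∀ x, τ x.succ = (e x).succ := fun x => by
    rw [hτ, decomposeFin_symm_apply_succ, swap_self, refl_apply]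
  let f : τ.CycleQuotient → Option e.CycleQuotient :=
    Quotient.lift (Fin.cases none (fun x => some (Quotient.mk _ x)))
      (fun a b hab => SameCycle.apply_eq_of_invariant (π := τ) (fun x => by
        induction x using Fin.cases with
        | zero => rw [h0]
        | succ x =>
          rw [hs]
          exact congrArg some (CycleQuotient.mk_apply e x)) hab)
  let g : Option e.CycleQuotient → τ.CycleQuotient := fun o => o.elim (Quotient.mk _ 0)
    (Quotient.lift (fun x => Quotient.mk _ x.succ)
      (fun a b hab => SameCycle.apply_eq_of_invariant (π := e)
        (f := fun x => (Quotient.mk _ x.succ : τ.CycleQuotient)) (fun x => by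
          rw [← hs]
          exact CycleQuotient.mk_apply τ x.succ) hab))
  refine Nat.card_congr ⟨f, g, fun q => ?_, fun q => ?_⟩
  · induction q using Quotient.inductionOn with | _ a
    induction a using Fin.cases with
    | zero => rfl
    | succ x => rfl
  · cases q with
    | none => rfl
    | some q =>
      induction q using Quotient.inductionOn with | _ a
      rfl

end Equiv.Perm

theorem stirlingFirst_eq_sum (n k : ℕ) :
    stirlingFirst n k = ∑ π : Equiv.Perm (Fin n), if π.numCycles = k then 1 else 0 := by
  classical
  rw [stirlingFirst, Nat.card_eq_fintype_card, Fintype.card_subtype, Finset.card_filter]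

theorem stirlingFirst_eq_natStirlingFirst (n k : ℕ) :
    stirlingFirst n k = Nat.stirlingFirst n k := by
  induction n generalizing k with
  | zero =>
    have h : ∀ π : Equiv.Perm (Fin 0), π.numCycles = 0 := fun π => by
      rw [Equiv.Perm.numCycles_eq_card_cycleQuotient, Nat.card_eq_zero]
      exact Or.inl ⟨fun q => q.inductionOn fun a => a.elim0⟩
    rw [stirlingFirst_eq_sum]
    cases k <;> simp [h]
  | succ n ih =>
    rw [stirlingFirst_eq_sum, ← Equiv.sum_comp Equiv.Perm.decomposeFin.symm,
      Fintype.sum_prod_type, Fin.sum_univ_succ]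
    simp only [Equiv.Perm.numCycles_decomposeFin_symm_zero,
      Equiv.Perm.numCycles_decomposeFin_symm_succ, ← stirlingFirst_eq_sum, ih]
    cases k with
    | zero => cases n <;> simp
    | succ k =>
      simp only [Nat.add_right_cancel_iff, ← stirlingFirst_eq_sum, ih,
        Nat.stirlingFirst_succ_succ, Finset.sum_const, Finset.card_univ, Fintype.card_fin,
        smul_eq_mul]
      ring

/-- The Stirling number `[n + 1, k + 1]` divided by `n!`; it is the `k`-th elementary symmetric
function of `1, 1/2, …, 1/n`. -/
noncomputable def normalizedStirling (n k : ℕ) : ℝ :=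
  (Nat.stirlingFirst (n + 1) (k + 1) : ℝ) / (n.factorial : ℝ)

namespace normalizedStirling

theorem nonneg (n k : ℕ) : 0 ≤ normalizedStirling n k := by
  unfold normalizedStirling
  positivity

theorem zero_right (n : ℕ) : normalizedStirling n 0 = 1 := by
  rw [normalizedStirling, Nat.stirlingFirst_one_right]
  exact div_self (by positivity)

theorem zero_succ (k : ℕ) : normalizedStirling 0 (k + 1) = 0 := by
  rw [normalizedStirling, Nat.stirlingFirst_eq_zero_of_lt (by omega)]
  simp

theorem self (n : ℕ) : normalizedStirling n n = 1 / (n.factorial : ℝ) := by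
  rw [normalizedStirling, Nat.stirlingFirst_self, Nat.cast_one]

theorem succ_succ (n k : ℕ) :
    normalizedStirling (n + 1) (k + 1) =
      normalizedStirling n (k + 1) + normalizedStirling n k * ((n : ℝ) + 1)⁻¹ := by
  unfold normalizedStirling
  rw [Nat.stirlingFirst_succ_succ (n + 1) (k + 1), Nat.factorial_succ]
  push_cast
  have : (n.factorial : ℝ) ≠ 0 := by positivity
  field_simp

theorem monotone (k : ℕ) : Monotone fun n => normalizedStirling n k := by
  refine monotone_nat_of_le_succ fun n => ?_
  cases k with
  | zero => simp only [zero_right, le_refl]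
  | succ k =>
    rw [succ_succ]
    have := nonneg n k
    exact le_add_of_nonneg_right (by positivity)

theorem le_harmonic_pow (n k : ℕ) : normalizedStirling n k ≤ (harmonic n : ℝ) ^ k := by
  induction n generalizing k with
  | zero =>
    cases k with
    | zero => simp [zero_right]
    | succ k => simp [zero_succ]
  | succ n ih =>
    cases k with
    | zero => simp [zero_right]
    | succ k =>
      have hH : (0 : ℝ) ≤ (harmonic n : ℝ) := by
        unfold harmonic
        push_cast
        positivity
      rw [succ_succ, harmonic_succ]
      push_cast
      set t : ℝ := ((n : ℝ) + 1)⁻¹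
      have ht : 0 ≤ t := by positivity
      calc normalizedStirling n (k + 1) + normalizedStirling n k * t
          ≤ (harmonic n : ℝ) ^ (k + 1) + (harmonic n : ℝ) ^ k * t := by
            gcongr <;> apply ih
        _ = (harmonic n : ℝ) ^ k * (harmonic n + t) := by ring
        _ ≤ (harmonic n + t : ℝ) ^ k * (harmonic n + t) := by
            gcongr
            linarith
        _ = _ := by ring

/-- A discrete mean value estimate for the positive part of a power. -/
theorem _root_.max_zero_pow_succ_add_le (y t : ℝ) (ht : 0 ≤ t) (k : ℕ) :
    max (y + t) 0 ^ (k + 1) ≤ max y 0 ^ (k + 1) + (k + 1) * t * max (y + t) 0 ^ k := by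
  have hz : 0 ≤ max y 0 := le_max_right _ _
  have hw : 0 ≤ max (y + t) 0 := le_max_right _ _
  have hzw : max y 0 ≤ max (y + t) 0 := max_le_max_right 0 (by linarith)
  have hwz : max (y + t) 0 ≤ max y 0 + t :=
    max_le (by linarith [le_max_left y 0]) (by linarith)
  generalize max y 0 = z at *
  generalize max (y + t) 0 = w at *
  induction k with
  | zero => simpa using hwz
  | succ k ih =>
    have h1 : z ^ (k + 1) ≤ w ^ (k + 1) := by gcongr
    calc w ^ (k + 1 + 1) = w * w ^ (k + 1) := by ring
      _ ≤ w * (z ^ (k + 1) + (k + 1) * t * w ^ k) := by gcongr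
      _ = w * z ^ (k + 1) + (k + 1) * t * w ^ (k + 1) := by ring
      _ ≤ (z + t) * z ^ (k + 1) + (k + 1) * t * w ^ (k + 1) := by gcongr
      _ = z ^ (k + 1 + 1) + t * z ^ (k + 1) + (k + 1) * t * w ^ (k + 1) := by ring
      _ ≤ z ^ (k + 1 + 1) + t * w ^ (k + 1) + (k + 1) * t * w ^ (k + 1) := by gcongr
      _ = _ := by push_cast; ring

theorem harmonic_sub_pow_le (n k : ℕ) :
    max ((harmonic n : ℝ) - k) 0 ^ k ≤ k.factorial * normalizedStirling n k := by
  induction n generalizing k with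
  | zero =>
    cases k with
    | zero => simp [zero_right]
    | succ k =>
      have : ((harmonic 0 : ℚ) : ℝ) - ((k + 1 : ℕ) : ℝ) ≤ 0 := by
        simp only [harmonic_zero, Rat.cast_zero]
        push_cast
        have : (0 : ℝ) ≤ k := by positivity
        linarith
      rw [max_eq_right this, zero_succ]
      simp
  | succ n ih =>
    cases k with
    | zero => simp [zero_right]
    | succ k =>
      have ih1 := ih (k + 1)
      have ih2 := ih k
      rw [succ_succ, harmonic_succ]
      push_cast at ih1 ⊢
      set t : ℝ := ((n : ℝ) + 1)⁻¹ with ht_def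
      have ht : 0 ≤ t := by positivity
      have ht1 : t ≤ 1 := inv_le_one_of_one_le₀ (by linarith [(Nat.cast_nonneg n : (0 : ℝ) ≤ n)])
      have h := max_zero_pow_succ_add_le ((harmonic n : ℝ) - (k + 1)) t ht k
      have h2 : max ((harmonic n : ℝ) - (k + 1) + t) 0 ^ k ≤ max ((harmonic n : ℝ) - k) 0 ^ k :=
        pow_le_pow_left₀ (le_max_right _ _) (max_le_max_right 0 (by linarith)) k
      calc max ((harmonic n : ℝ) + t - (k + 1)) 0 ^ (k + 1)
          = max ((harmonic n : ℝ) - (k + 1) + t) 0 ^ (k + 1) := by ring_nf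
        _ ≤ _ := h
        _ ≤ (k + 1).factorial * normalizedStirling n (k + 1) +
              (k + 1) * t * (k.factorial * normalizedStirling n k) := by
            gcongr
            exact h2.trans ih2
        _ = _ := by
            rw [Nat.factorial_succ]
            push_cast
            ring

theorem pos {n k : ℕ} (h : k ≤ n) : 0 < normalizedStirling n k :=
  lt_of_lt_of_le (by beta_reduce; rw [self]; positivity) (monotone k h)

theorem log_div_pow_le {n k : ℕ} (h : k ≤ n) :
    (Real.log ((n : ℝ) + 1) / (2 * k + 2)) ^ k ≤ k.factorial * normalizedStirling n k := by
  have hlog : 0 ≤ Real.log ((n : ℝ) + 1) :=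
    Real.log_nonneg (by linarith [(Nat.cast_nonneg n : (0 : ℝ) ≤ n)])
  have hH : Real.log ((n : ℝ) + 1) ≤ harmonic n := by
    exact_mod_cast log_add_one_le_harmonic n
  have hk : (0 : ℝ) ≤ k := Nat.cast_nonneg k
  rcases le_total (2 * (k : ℝ)) (harmonic n) with hc | hc
  · refine le_trans (pow_le_pow_left₀ (by positivity) ?_ k) (harmonic_sub_pow_le n k)
    refine le_trans ?_ (le_max_left _ _)
    calc Real.log ((n : ℝ) + 1) / (2 * k + 2) ≤ Real.log ((n : ℝ) + 1) / 2 := by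
          gcongr
          linarith
      _ ≤ _ := by linarith
  · have h1 : (k.factorial : ℝ) * normalizedStirling k k = 1 := by
      rw [self, mul_one_div, div_self (by positivity)]
    calc (Real.log ((n : ℝ) + 1) / (2 * k + 2)) ^ k ≤ 1 := by
          refine pow_le_one₀ (by positivity) ?_
          rw [div_le_one (by positivity)]
          linarith
      _ = k.factorial * normalizedStirling k k := h1.symm
      _ ≤ _ := by
          gcongr
          exact monotone k h

theorem le_mul_log_pow {n k : ℕ} (h : k ≤ n) :
    normalizedStirling n k ≤ (1 / Real.log 2 + 1) ^ k * Real.log ((n : ℝ) + 1) ^ k := by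
  cases k with
  | zero => simp [zero_right]
  | succ k =>
    have hl2 : 0 < Real.log 2 := Real.log_pos (by norm_num)
    have hn : (1 : ℝ) ≤ n := by exact_mod_cast (show 1 ≤ n by omega)
    have hlog : Real.log 2 ≤ Real.log ((n : ℝ) + 1) := Real.log_le_log (by norm_num) (by linarith)
    have hH : (harmonic n : ℝ) ≤ 1 + Real.log n := harmonic_le_one_add_log n
    have hmono : Real.log n ≤ Real.log ((n : ℝ) + 1) := Real.log_le_log (by linarith) (by linarith)
    have h0 : (0 : ℝ) ≤ (harmonic n : ℝ) := by
      unfold harmonic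
      push_cast
      positivity
    rw [← mul_pow]
    refine (le_harmonic_pow n (k + 1)).trans (pow_le_pow_left₀ h0 ?_ _)
    have : 1 ≤ 1 / Real.log 2 * Real.log ((n : ℝ) + 1) := by
      rw [one_div, ← div_eq_inv_mul, one_le_div hl2]
      exact hlog
    linarith

end normalizedStirling

/-- For every positive integer `k` there are positive constants `α(k), β(k)` with
`α(k)·(n-1)!·(ln n)^(k-1) < [n, k] < β(k)·(n-1)!·(ln n)^(k-1)` for all `n ≥ k`. -/
theorem stmt3 (k : ℕ) (hk : 0 < k) :
    ∃ α β : ℝ, 0 < α ∧ 0 < β ∧ ∀ n : ℕ, k ≤ n →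
      α * (Nat.factorial (n - 1)) * (Real.log n) ^ (k - 1) < stirlingFirst n k ∧
      (stirlingFirst n k : ℝ) < β * (Nat.factorial (n - 1)) * (Real.log n) ^ (k - 1) := by
  obtain ⟨k, rfl⟩ : ∃ j, k = j + 1 := ⟨k - 1, by omega⟩
  refine ⟨1 / (2 * k.factorial * (2 * k + 2) ^ k), 2 * (1 / Real.log 2 + 1) ^ k,
    by positivity, ?_, fun n hn => ?_⟩
  · have : 0 < Real.log 2 := Real.log_pos (by norm_num)
    positivity
  obtain ⟨n, rfl⟩ : ∃ m, n = m + 1 := ⟨n - 1, by omega⟩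
  have hkn : k ≤ n := by omega
  have hpos := normalizedStirling.pos hkn
  have hlow := normalizedStirling.log_div_pow_le hkn
  have hup := normalizedStirling.le_mul_log_pow hkn
  have hfac : (0 : ℝ) < n.factorial := by positivity
  have hS : (stirlingFirst (n + 1) (k + 1) : ℝ) = n.factorial * normalizedStirling n k := by
    rw [stirlingFirst_eq_natStirlingFirst, normalizedStirling, mul_div_cancel₀ _ hfac.ne']
  rw [hS]
  simp only [Nat.add_sub_cancel, Nat.cast_add, Nat.cast_one]
  set L := Real.log ((n : ℝ) + 1)
  constructor
  · rw [mul_comm _ (n.factorial : ℝ), mul_assoc]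
    refine mul_lt_mul_of_pos_left ?_ hfac
    have hk0 : (0 : ℝ) < k.factorial := by positivity
    have hM : (0 : ℝ) < (2 * k + 2) ^ k := by positivity
    rw [div_pow, div_le_iff₀ hM] at hlow
    rw [one_div, inv_mul_lt_iff₀ (by positivity)]
    have : 0 < k.factorial * normalizedStirling n k * (2 * k + 2) ^ k := by positivity
    linarith
  · rw [mul_comm _ (n.factorial : ℝ), mul_assoc]
    refine mul_lt_mul_of_pos_left ?_ hfac
    linarith
end

section
/- Let k ≥ 2 and let A ⊆ S_{n,k}. If every independent subset of A has size at most l, then |A| ≤ k·l·[n-1, k-1], where [n-1, k-1] is the number of permutations of an (n-1)-element set with exactly k-1 cycles. -/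
namespace Equiv.Perm

open Classical in
/-- The element of `π.cycleSet` containing `a`. -/
noncomputable def cycleThrough {n : ℕ} (π : Perm (Fin n)) (a : Fin n) :
    Finset (Fin n) × (Fin n → Fin n) :=
  (Finset.univ.filter (π.SameCycle a), fun x => if π.SameCycle a x then π x else x)

theorem cycleSet_eq_range {n : ℕ} (π : Perm (Fin n)) :
    π.cycleSet = Set.range π.cycleThrough := by
  ext ⟨S, f⟩
  constructor
  · rintro ⟨⟨a, ha⟩, hf⟩
    refine ⟨a, Prod.ext ?_ ?_⟩
    · ext x
      simpa [cycleThrough] using (ha x).symm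
    · funext x
      simp only at ha hf
      simp [cycleThrough, hf, ha]
  · rintro ⟨a, h⟩
    simp only [cycleThrough, Prod.mk.injEq] at h
    obtain ⟨rfl, rfl⟩ := h
    exact ⟨⟨a, fun x => by simp⟩, by simp⟩

theorem cycleThrough_eq_iff {n : ℕ} (π : Perm (Fin n)) (a b : Fin n) :
    π.cycleThrough a = π.cycleThrough b ↔ π.SameCycle a b := by
  constructor
  · intro h
    have hb : b ∈ (π.cycleThrough a).1 := by rw [h]; simp [cycleThrough, SameCycle.refl]
    simpa [cycleThrough] using hb
  · intro h
    have key : ∀ x, π.SameCycle a x ↔ π.SameCycle b x := fun x =>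
      ⟨fun hx => h.symm.trans hx, fun hx => h.trans hx⟩
    simp [cycleThrough, key]

theorem numCycles_eq_card_quotient {n : ℕ} (π : Perm (Fin n)) :
    π.numCycles = Nat.card (Quotient (SameCycle.setoid π)) := by
  have hker : Setoid.ker π.cycleThrough = SameCycle.setoid π := by
    ext a b
    exact π.cycleThrough_eq_iff a b
  rw [numCycles, cycleSet_eq_range, ← Nat.card_coe_set_eq, ← hker]
  exact (Nat.card_congr (Setoid.quotientKerEquivRange _)).symm

theorem numCycles_extendDomain {m : ℕ} (a : Fin (m + 1)) (τ : Perm (Fin m)) :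
    (τ.extendDomain (finSuccAboveEquiv a)).numCycles = τ.numCycles + 1 := by
  set e := (finSuccAboveEquiv a)
  set σ := τ.extendDomain e
  have hσa : σ a = a := extendDomain_apply_not_subtype _ _ (by simp)
  have hiff : ∀ x y, σ.SameCycle (e x) (e y) ↔ τ.SameCycle x y := fun x y =>
    sameCycle_extendDomain
  have hfix : ∀ x, ¬ σ.SameCycle a (e x) := fun x h =>
    (e x).2 (h.eq_of_left hσa).symm
  rw [numCycles_eq_card_quotient, numCycles_eq_card_quotient, ← Finite.card_option]
  let F : Option (Quotient (SameCycle.setoid τ)) → Quotient (SameCycle.setoid σ) := fun o =>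
    o.elim ⟦a⟧ (Quotient.map (fun x => (e x : Fin (m + 1))) fun x y h => (hiff x y).2 h)
  refine (Nat.card_eq_of_bijective F ⟨?_, ?_⟩).symm
  · rintro (_ | x) (_ | y) h
    · rfl
    · induction y using Quotient.inductionOn
      exact (hfix _ (Quotient.exact h)).elim
    · induction x using Quotient.inductionOn
      exact (hfix _ (Quotient.exact h.symm)).elim
    · induction x using Quotient.inductionOn
      induction y using Quotient.inductionOn
      exact congrArg some (Quotient.sound ((hiff _ _).1 (Quotient.exact h)))
  · rintro ⟨y⟩
    by_cases hy : y = a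
    · exact ⟨none, by subst hy; rfl⟩
    · exact ⟨some ⟦e.symm ⟨y, hy⟩⟧, congrArg (Quotient.mk _) (by simp)⟩

theorem exists_extendDomain_eq {m : ℕ} {a : Fin (m + 1)} {σ : Perm (Fin (m + 1))}
    (h : σ a = a) :
    ∃ τ : Perm (Fin m), τ.extendDomain (finSuccAboveEquiv a) = σ := by
  set e := (finSuccAboveEquiv a)
  have hσ : ∀ x, σ x ≠ a ↔ x ≠ a := fun x => by
    conv_lhs => rw [← h]
    exact σ.injective.ne_iff
  refine ⟨e.symm.permCongr (σ.subtypePerm hσ), ?_⟩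
  ext x
  by_cases hx : x = a
  · subst hx
    rw [extendDomain_apply_not_subtype _ _ (by simp), h]
  · rw [extendDomain_apply_subtype (p := fun x => x ≠ a) _ _ hx]
    simp [Equiv.permCongr_apply]

theorem ncard_fixing_le {m j : ℕ} (a : Fin (m + 1)) :
    {σ : Perm (Fin (m + 1)) | σ.numCycles = j + 1 ∧ σ a = a}.ncard ≤ stirlingFirst m j := by
  change _ ≤ Nat.card {τ : Perm (Fin m) | τ.numCycles = j}
  rw [Nat.card_coe_set_eq]
  refine (Set.ncard_le_ncard ?_ (Set.toFinite _)).trans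
    (Set.ncard_image_le (f := fun τ => τ.extendDomain (finSuccAboveEquiv a))
      (Set.toFinite _))
  rintro σ ⟨hc, ha⟩
  obtain ⟨τ, rfl⟩ := exists_extendDomain_eq ha
  rw [numCycles_extendDomain] at hc
  exact ⟨τ, by simpa using hc, rfl⟩

/-- Moving all elements of the cycle of `a`, except `a` itself, into the cycle of `b`
preserves the number of cycles. -/
theorem numCycles_mul_swap_mul_swap {n : ℕ} (π : Perm (Fin n)) {a b p : Fin n}
    (hp : π p = a) (hpa : p ≠ a) (hb : ¬ π.SameCycle a b) :
    (π * swap a p * swap p b).numCycles = π.numCycles := by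
  classical
  set σ := π * swap a p * swap p b with hσ
  have hap : π.SameCycle a p := by
    rw [← hp]; exact (sameCycle_apply_left.2 (SameCycle.refl _ _))
  have hba : b ≠ a := fun h => hb (h ▸ SameCycle.refl _ _)
  have hbp : b ≠ p := fun h => hb (h ▸ hap)
  have σa : σ a = a := by
    simp [hσ, swap_apply_of_ne_of_ne hpa.symm hba.symm, hp]
  have σp : σ p = π b := by simp [hσ, swap_apply_of_ne_of_ne hba hbp]
  have σb : σ b = π a := by simp [hσ]
  have σx : ∀ x, x ≠ a → x ≠ p → x ≠ b → σ x = π x := fun x h₁ h₂ h₃ => by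
    simp [hσ, swap_apply_of_ne_of_ne h₂ h₃, swap_apply_of_ne_of_ne h₁ h₂]
  let g : Fin n → Fin n := fun x => if π.SameCycle a x ∧ x ≠ a then b else x
  have ga : g a = a := by simp [g]
  have g_in : ∀ x, π.SameCycle a x → x ≠ a → g x = b := fun x h₁ h₂ => if_pos ⟨h₁, h₂⟩
  have g_out : ∀ x, ¬ π.SameCycle a x → g x = x := fun x h => if_neg fun h' => h h'.1
  have forward : ∀ x, π.SameCycle (g x) (g (σ x)) := by
    intro x
    by_cases hxa : x = a
    · subst hxa; rw [σa]
    by_cases hxp : x = p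
    · subst hxp
      rw [σp, g_in x hap hpa, g_out _ (by rwa [sameCycle_apply_right])]
      exact sameCycle_apply_right.2 (SameCycle.refl _ _)
    by_cases hxb : x = b
    · subst hxb
      rw [σb, g_out x hb, g_in (π a) (sameCycle_apply_right.2 (SameCycle.refl _ _))]
      intro h
      exact hpa (π.injective (hp.trans h.symm))
    rw [σx x hxa hxp hxb]
    by_cases hx : π.SameCycle a x
    · rw [g_in x hx hxa, g_in _ (sameCycle_apply_right.2 hx)]
      intro h
      exact hxp (π.injective (h.trans hp.symm))
    · rw [g_out x hx, g_out _ (by rwa [sameCycle_apply_right])]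
      exact sameCycle_apply_right.2 (SameCycle.refl _ _)
  have pow_a : ∀ i : ℕ, (π ^ i) a = a ∨ σ.SameCycle b ((π ^ i) a) := by
    intro i
    induction i with
    | zero => simp
    | succ i ih =>
      rw [pow_succ', mul_apply]
      by_cases h₁ : (π ^ i) a = a
      · rw [h₁, ← σb]
        exact Or.inr (sameCycle_apply_right.2 (SameCycle.refl _ _))
      by_cases h₂ : (π ^ i) a = p
      · exact Or.inl (by rw [h₂, hp])
      have h₃ : (π ^ i) a ≠ b := fun h => hb ⟨i, by simpa using h⟩
      rw [← σx _ h₁ h₂ h₃, sameCycle_apply_right]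
      exact Or.inr (ih.resolve_left h₁)
  have joined : ∀ x, π.SameCycle a x → x ≠ a → σ.SameCycle b x := by
    intro x hx hxa
    obtain ⟨i, rfl⟩ := hx.exists_nat_pow_eq
    exact (pow_a i).resolve_left hxa
  have to_g : ∀ x, σ.SameCycle x (g x) := by
    intro x
    by_cases h : π.SameCycle a x ∧ x ≠ a
    · rw [g_in x h.1 h.2]
      exact (joined x h.1 h.2).symm
    · simp only [g, if_neg h]
      exact SameCycle.refl _ _
  have outside : ∀ u, ¬ π.SameCycle a u → ∀ i : ℕ, σ.SameCycle u ((π ^ i) u) := by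
    intro u hu i
    induction i with
    | zero => simp [SameCycle.refl]
    | succ i ih =>
      rw [pow_succ', mul_apply]
      have hi : ¬ π.SameCycle a ((π ^ i) u) := by rwa [sameCycle_pow_right]
      by_cases h : (π ^ i) u = b
      · rw [h, ← σp, sameCycle_apply_right]
        exact (h ▸ ih).trans (joined p hap hpa)
      · rw [← σx _ (fun h' => hi (h' ▸ SameCycle.refl _ _)) (fun h' => hi (h' ▸ hap)) h,
          sameCycle_apply_right]
        exact ih
  have not_mem_g : ∀ x, x ≠ a → ¬ π.SameCycle a (g x) := by
    intro x hx
    by_cases h : π.SameCycle a x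
    · rwa [g_in x h hx]
    · rwa [g_out x h]
  have iff : ∀ x y, σ.SameCycle x y ↔ π.SameCycle (g x) (g y) := by
    intro x y
    constructor
    · intro h
      obtain ⟨i, rfl⟩ := h.exists_nat_pow_eq
      clear h
      induction i with
      | zero => simp [SameCycle.refl]
      | succ i ih =>
        rw [pow_succ', mul_apply]
        exact ih.trans (forward _)
    · intro h
      by_cases hx : x = a
      · by_cases hy : y = a
        · rw [hx, hy]
        · exact (not_mem_g y hy (by rwa [hx, ga] at h)).elim
      · obtain ⟨i, hi⟩ := h.exists_nat_pow_eq
        have := outside (g x) (not_mem_g x hx) i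
        rw [hi] at this
        exact (to_g x).trans (this.trans (to_g y).symm)
  rw [numCycles_eq_card_quotient, numCycles_eq_card_quotient]
  refine Nat.card_eq_of_bijective
    (Quotient.map g fun x y h => (iff x y).1 h :
      Quotient (SameCycle.setoid σ) → Quotient (SameCycle.setoid π)) ⟨?_, ?_⟩
  · rintro ⟨x⟩ ⟨y⟩ h
    exact Quotient.sound ((iff x y).2 (Quotient.exact h))
  · rintro ⟨y⟩
    by_cases hy : π.SameCycle a y
    · exact ⟨⟦a⟧, Quotient.sound (by rw [ga]; exact hy)⟩
    · exact ⟨⟦y⟧, congrArg (Quotient.mk _) (g_out y hy)⟩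

/-- Two or more cycles leave an element outside any given one. -/
theorem exists_not_sameCycle {n : ℕ} {π : Perm (Fin n)} (h : 2 ≤ π.numCycles) (a : Fin n) :
    ∃ b, ¬ π.SameCycle a b := by
  by_contra! hall
  have : Subsingleton (Quotient (SameCycle.setoid π)) :=
    ⟨by rintro ⟨x⟩ ⟨y⟩; exact Quotient.sound ((hall x).symm.trans (hall y))⟩
  have := Finite.card_le_one_iff_subsingleton.2 this
  rw [← numCycles_eq_card_quotient] at this
  omega

theorem ncard_mem_cycleSet_le {n k : ℕ} (hk : 2 ≤ k) (c : Finset (Fin n) × (Fin n → Fin n)) :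
    {π : Perm (Fin n) | π.numCycles = k ∧ c ∈ π.cycleSet}.ncard ≤
      stirlingFirst (n - 1) (k - 1) := by
  rcases Set.eq_empty_or_nonempty
    {π : Perm (Fin n) | π.numCycles = k ∧ c ∈ π.cycleSet} with h | ⟨π₀, hπ₀, hc₀⟩
  · simp [h]
  obtain ⟨⟨a, ha⟩, hf₀⟩ := hc₀
  obtain ⟨b, hb⟩ := exists_not_sameCycle (hk.trans hπ₀.ge) a
  obtain ⟨m, rfl⟩ : ∃ m, n = m + 1 := ⟨n - 1, by have := a.pos; omega⟩
  obtain ⟨j, rfl⟩ : ∃ j, k = j + 1 := ⟨k - 1, by omega⟩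
  have haS : a ∈ c.1 := (ha a).2 (SameCycle.refl _ _)
  have hbS : b ∉ c.1 := fun h => hb ((ha b).1 h)
  have hpS : π₀⁻¹ a ∈ c.1 := (ha _).2 ⟨-1, by simp⟩
  have agree : ∀ π : Perm (Fin (m + 1)), c ∈ π.cycleSet → ∀ x ∈ c.1, π x = π₀ x := by
    rintro π ⟨-, hf⟩ x hx
    have := congrFun (hf.symm.trans hf₀) x
    simpa [hx] using this
  refine le_trans ?_ (ncard_fixing_le a)
  by_cases hp : π₀⁻¹ a = a
  · refine Set.ncard_le_ncard ?_ (Set.toFinite _)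
    rintro π ⟨hπ, hc⟩
    refine ⟨hπ, ?_⟩
    rw [agree π hc a haS]
    exact (inv_eq_iff_eq.1 hp).symm
  · refine Set.ncard_le_ncard_of_injOn (fun π => π * swap a (π₀⁻¹ a) * swap (π₀⁻¹ a) b) ?_ ?_
      (Set.toFinite _)
    · rintro π ⟨hπ, hc⟩
      have hpa : π (π₀⁻¹ a) = a := by rw [agree π hc _ hpS]; simp
      have hba : b ≠ a := fun h => hbS (h ▸ haS)
      have hnot : ¬ π.SameCycle a b := by
        obtain ⟨⟨a', ha'⟩, -⟩ := hc
        exact fun h => hbS ((ha' b).2 (((ha' a).1 haS).trans h))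
      refine ⟨(π.numCycles_mul_swap_mul_swap hpa hp hnot).trans hπ, ?_⟩
      rw [mul_apply, swap_apply_of_ne_of_ne (Ne.symm hp) hba.symm, mul_apply, swap_apply_left, hpa]
    · intro π _ π' _ h
      simpa using h

end Equiv.Perm

/-- If `k ≥ 2` and every independent subset of `A ⊆ S_{n,k}` has size at most `l`,
then `|A| ≤ k·l·[n-1, k-1]`. -/
theorem stmt8 (n k l : ℕ) (hk : 2 ≤ k) (A : Set (Equiv.Perm (Fin n)))
    (hA : ∀ π ∈ A, π.numCycles = k)
    (hindep : ∀ B ⊆ A,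
      (∀ π₁ ∈ B, ∀ π₂ ∈ B, π₁ ≠ π₂ → π₁.cycleSet ∩ π₂.cycleSet = ∅) →
      B.ncard ≤ l) :
    A.ncard ≤ k * l * stirlingFirst (n - 1) (k - 1) := by
  classical
  obtain ⟨B, hB⟩ := (Set.toFinite {B : Set (Equiv.Perm (Fin n)) | B ⊆ A ∧
      ∀ π₁ ∈ B, ∀ π₂ ∈ B, π₁ ≠ π₂ → π₁.cycleSet ∩ π₂.cycleSet = ∅}).exists_maximal
    ⟨∅, Set.empty_subset _, by simp⟩
  obtain ⟨⟨hBA, hBi⟩, hmax⟩ := hB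
  have cover : ∀ π ∈ A, ∃ β ∈ B, (π.cycleSet ∩ β.cycleSet).Nonempty := by
    intro π hπ
    by_cases hπB : π ∈ B
    · refine ⟨π, hπB, ?_⟩
      rw [Set.inter_self]
      refine Set.nonempty_of_ncard_ne_zero ?_
      have : π.cycleSet.ncard = k := hA π hπ
      omega
    · by_contra! hdisj
      refine hπB (hmax (y := insert π B) ⟨Set.insert_subset hπ hBA, ?_⟩
        (Set.subset_insert _ _) (Set.mem_insert _ _))
      rintro π₁ (rfl | h₁) π₂ (rfl | h₂) hne
      · exact (hne rfl).elim
      · exact hdisj π₂ h₂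
      · rw [Set.inter_comm]
        exact hdisj π₁ h₁
      · exact hBi π₁ h₁ π₂ h₂ hne
  let cyc : Finset (Finset (Fin n) × (Fin n → Fin n)) :=
    B.toFinite.toFinset.biUnion fun β => β.cycleSet.toFinite.toFinset
  have hcyc : cyc.card ≤ k * l := by
    refine (Finset.card_biUnion_le_card_mul _ _ k fun β hβ => ?_).trans ?_
    · rw [← Set.ncard_eq_toFinset_card]
      exact (hA β (hBA (by simpa using hβ))).le
    · rw [← Set.ncard_eq_toFinset_card, mul_comm]
      exact Nat.mul_le_mul_left k (hindep B hBA hBi)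
  let fib : Finset (Fin n) × (Fin n → Fin n) → Finset (Equiv.Perm (Fin n)) := fun c =>
    (Set.toFinite {π : Equiv.Perm (Fin n) | π.numCycles = k ∧ c ∈ π.cycleSet}).toFinset
  have hsub : A ⊆ (cyc.biUnion fib : Finset (Equiv.Perm (Fin n))) := by
    intro π hπ
    obtain ⟨β, hβ, c, hcπ, hcβ⟩ := cover π hπ
    simp only [Finset.coe_biUnion, Set.mem_iUnion, Finset.mem_coe]
    exact ⟨c, by simpa [cyc] using ⟨β, hβ, hcβ⟩, by simpa [fib] using ⟨hA π hπ, hcπ⟩⟩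
  calc A.ncard ≤ (cyc.biUnion fib).card := by
        rw [← Set.ncard_coe_finset]
        exact Set.ncard_le_ncard hsub (Set.toFinite _)
    _ ≤ cyc.card * stirlingFirst (n - 1) (k - 1) := by
        refine Finset.card_biUnion_le_card_mul _ _ _ fun c _ => ?_
        rw [← Set.ncard_eq_toFinset_card]
        exact Equiv.Perm.ncard_mem_cycleSet_le hk c
    _ ≤ k * l * stirlingFirst (n - 1) (k - 1) := Nat.mul_le_mul_right _ hcyc
end

section
/- Let k ≥ t+2, let A ⊆ S_{n,k} be t-intersecting, and fix π₀ ∈ A. Suppose that for every t-element subset T of M(π₀), every independent subset of the family A(T) = {π ∈ A : T ⊆ M(π)} in which all shared cycles beyond T are excluded (i.e., every subset B ⊆ A(T) with M(π₁) ∩ M(π₂) = T for all distinct π₁, π₂ ∈ B) has size at most k. Then |A| ≤ k² · C(k,t) · [n-t-1, k-t-1], where C(k,t) is the binomial coefficient and [m, j] is the number of permutations of an m-element set with exactly j cycles. -/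
namespace Equiv.Perm

/-- The set of orbits of a permutation. -/
def orbitSet {α : Type*} (σ : Perm α) : Set (Set α) :=
  Set.range fun a => {x | σ.SameCycle a x}

theorem ncard_orbitSet_eq_of_surjective {α β : Type*} {σ : Perm α} {τ : Perm β} {p : β → α}
    (hp : Function.Surjective p)
    (h : ∀ z w, τ.SameCycle z w ↔ σ.SameCycle (p z) (p w)) :
    τ.orbitSet.ncard = σ.orbitSet.ncard := by
  have key : τ.orbitSet = (fun s => p ⁻¹' s) '' σ.orbitSet := by
    ext s
    simp only [orbitSet, Set.mem_range, Set.mem_image, exists_exists_eq_and]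
    have hs : ∀ b, {x | τ.SameCycle b x} = p ⁻¹' {y | σ.SameCycle (p b) y} := fun b => by
      ext w
      exact h b w
    constructor
    · rintro ⟨b, rfl⟩
      exact ⟨p b, (hs b).symm⟩
    · rintro ⟨a, rfl⟩
      obtain ⟨b, rfl⟩ := hp a
      exact ⟨b, hs b⟩
  rw [key, Set.ncard_image_of_injective _ hp.preimage_injective]

theorem SameCycle.induction_on {α : Type*} {σ : Perm α} {r : α → α → Prop} (hr : Equivalence r)
    (h : ∀ x, r x (σ x)) {x y : α} (hxy : σ.SameCycle x y) : r x y := by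
  have hn : ∀ (n : ℕ) (x : α), r x ((σ ^ n) x) := by
    intro n
    induction n with
    | zero => exact fun x => hr.refl x
    | succ n ih =>
      intro x
      rw [pow_succ', mul_apply]
      exact hr.trans (ih x) (h _)
  obtain ⟨i, rfl⟩ := hxy
  obtain ⟨n, rfl | rfl⟩ := i.eq_nat_or_neg
  · simpa using hn n x
  · have := hn n ((σ ^ (-(n : ℤ))) x)
    refine hr.symm ?_
    simpa using this

/-- Insert a new point right after `a` into the cycle of `σ` containing `a`. -/
def insertAfter {α : Type*} [DecidableEq α] (a : α) (σ : Perm α) : Perm (Option α) :=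
  optionCongr σ * swap none (some a)

theorem insertAfter_injective {α : Type*} [DecidableEq α] (a : α) :
    Function.Injective (insertAfter a) := fun _ _ h =>
  optionCongr_injective (mul_right_cancel h)

theorem ncard_orbitSet_insertAfter {α : Type*} [DecidableEq α] (a : α) (σ : Perm α) :
    (insertAfter a σ).orbitSet.ncard = σ.orbitSet.ncard := by
  have h_none : insertAfter a σ none = some (σ a) := by simp [insertAfter]
  have h_a : insertAfter a σ (some a) = none := by simp [insertAfter]
  have h_some : ∀ x, x ≠ a → insertAfter a σ (some x) = some (σ x) := by
    intro x hx
    simp [insertAfter, swap_apply_of_ne_of_ne, hx]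
  have hstep : ∀ z, (insertAfter a σ).SameCycle z (insertAfter a σ z) := fun z =>
    sameCycle_apply_right.2 (SameCycle.refl _ _)
  have hnone : (insertAfter a σ).SameCycle none (some a) := by
    simpa [h_a] using (hstep (some a)).symm
  let p : Option α → α := fun z => z.getD a
  have hp : ∀ z, (insertAfter a σ).SameCycle z (some (p z)) := by
    rintro (_ | x)
    · exact hnone
    · exact SameCycle.refl _ _
  refine ncard_orbitSet_eq_of_surjective (p := p) (fun x => ⟨some x, rfl⟩) fun z w => ?_
  constructor
  · refine fun h => SameCycle.induction_on (r := fun z w => σ.SameCycle (p z) (p w))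
      ⟨fun _ => SameCycle.refl _ _, fun h => h.symm, fun h h' => h.trans h'⟩ ?_ h
    rintro (_ | x)
    · rw [h_none]
      exact sameCycle_apply_right.2 (SameCycle.refl _ _)
    · by_cases hx : x = a
      · subst hx
        rw [h_a]
        exact SameCycle.refl _ _
      · rw [h_some x hx]
        exact sameCycle_apply_right.2 (SameCycle.refl _ _)
  · intro h
    refine (hp z).trans (SameCycle.trans ?_ (hp w).symm)
    refine SameCycle.induction_on (r := fun x y => (insertAfter a σ).SameCycle (some x) (some y))
      ⟨fun _ => SameCycle.refl _ _, fun h => h.symm, fun h h' => h.trans h'⟩ ?_ h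
    intro x
    by_cases hx : x = a
    · subst hx
      rw [← h_none]
      exact sameCycle_apply_right.2 hnone.symm
    · rw [← h_some x hx]
      exact hstep _

theorem numCycles_eq_ncard_orbitSet {n : ℕ} (π : Perm (Fin n)) :
    π.numCycles = π.orbitSet.ncard := by
  have hinj : Set.InjOn (fun c : Finset (Fin n) × (Fin n → Fin n) => (c.1 : Set (Fin n)))
      π.cycleSet := by
    rintro ⟨S, f⟩ ⟨-, hf⟩ ⟨S', f'⟩ ⟨-, hf'⟩ h
    obtain rfl : S = S' := by simpa using h
    simp_all
  rw [numCycles, ← hinj.ncard_image]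
  congr 1
  ext s
  constructor
  · rintro ⟨c, ⟨⟨a, ha⟩, -⟩, rfl⟩
    exact ⟨a, by ext x; simp [ha]⟩
  · rintro ⟨a, rfl⟩
    classical
    refine ⟨(Set.toFinset {x | π.SameCycle a x},
      fun x => if x ∈ Set.toFinset {x | π.SameCycle a x} then π x else x),
      ⟨⟨a, by simp⟩, rfl⟩, by simp⟩

theorem eq_of_mem_cycleSet {n : ℕ} {π : Perm (Fin n)} {c d : Finset (Fin n) × (Fin n → Fin n)}
    (hc : c ∈ π.cycleSet) (hd : d ∈ π.cycleSet) {x : Fin n} (hxc : x ∈ c.1) (hxd : x ∈ d.1) :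
    c = d := by
  obtain ⟨S, f⟩ := c
  obtain ⟨S', f'⟩ := d
  obtain ⟨⟨a, ha⟩, hf⟩ := hc
  obtain ⟨⟨b, hb⟩, hf'⟩ := hd
  obtain rfl : S = S' := by
    ext y
    have hab := ((ha x).1 hxc).trans ((hb x).1 hxd).symm
    exact ((ha y).trans ⟨fun h => hab.symm.trans h, fun h => hab.trans h⟩).trans (hb y).symm
  simp only [Prod.mk.injEq, true_and]
  exact hf.trans hf'.symm

theorem apply_mem_iff_of_mem_cycleSet {n : ℕ} {π : Perm (Fin n)}
    {c : Finset (Fin n) × (Fin n → Fin n)} (hc : c ∈ π.cycleSet) (x : Fin n) :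
    π x ∈ c.1 ↔ x ∈ c.1 := by
  obtain ⟨⟨a, ha⟩, -⟩ := hc
  rw [ha, ha, sameCycle_apply_right]

theorem nonempty_of_mem_cycleSet {n : ℕ} {π : Perm (Fin n)}
    {c : Finset (Fin n) × (Fin n → Fin n)} (hc : c ∈ π.cycleSet) : c.1.Nonempty := by
  obtain ⟨⟨a, ha⟩, -⟩ := hc
  exact ⟨a, (ha a).2 (SameCycle.refl _ _)⟩

/-- The points covered by a set of cycles. -/
def coveredPoints {n : ℕ} (U : Set (Finset (Fin n) × (Fin n → Fin n))) : Set (Fin n) :=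
  {x | ∃ c ∈ U, x ∈ c.1}

theorem ncard_le_ncard_coveredPoints {n : ℕ} {π : Perm (Fin n)}
    {U : Set (Finset (Fin n) × (Fin n → Fin n))} (hU : U ⊆ π.cycleSet) :
    U.ncard ≤ (coveredPoints U).ncard := by
  have hne : ∀ c : U, ∃ x, x ∈ c.1.1 := fun c => nonempty_of_mem_cycleSet (hU c.2)
  choose r hr using hne
  rw [← Nat.card_coe_set_eq, ← Nat.card_coe_set_eq]
  refine Nat.card_le_card_of_injective
    (fun c => (⟨r c, c.1, c.2, hr c⟩ : coveredPoints U)) fun c d h => Subtype.ext ?_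
  have h' : r c = r d := congrArg Subtype.val h
  exact eq_of_mem_cycleSet (hU c.2) (hU d.2) (hr c) (h' ▸ hr d)

theorem apply_notMem_coveredPoints_iff {n : ℕ} {π : Perm (Fin n)}
    {U : Set (Finset (Fin n) × (Fin n → Fin n))} (hU : U ⊆ π.cycleSet) (x : Fin n) :
    π x ∉ coveredPoints U ↔ x ∉ coveredPoints U := by
  have h : π x ∈ coveredPoints U ↔ x ∈ coveredPoints U :=
    exists_congr fun c => and_congr_right fun hc => apply_mem_iff_of_mem_cycleSet (hU hc) x
  exact not_congr h

theorem numCycles_eq_add_ncard_orbitSet_subtypePerm {n : ℕ} {π : Perm (Fin n)}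
    {U : Set (Finset (Fin n) × (Fin n → Fin n))} (hU : U ⊆ π.cycleSet) :
    π.numCycles = U.ncard +
      (π.subtypePerm (p := (· ∉ coveredPoints U))
        (apply_notMem_coveredPoints_iff hU)).orbitSet.ncard := by
  set ρ := π.subtypePerm (p := (· ∉ coveredPoints U)) (apply_notMem_coveredPoints_iff hU) with hρ
  have hinj : Set.InjOn (fun c : Finset (Fin n) × (Fin n → Fin n) => (c.1 : Set (Fin n))) U := by
    intro c hc d hd h
    obtain ⟨x, hx⟩ := nonempty_of_mem_cycleSet (hU hc)
    have hcd : c.1 = d.1 := by simpa using h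
    exact eq_of_mem_cycleSet (hU hc) (hU hd) hx (hcd ▸ hx)
  have hinj' : Function.Injective
      (fun s : Set {x // x ∉ coveredPoints U} => (Subtype.val '' s : Set (Fin n))) :=
    Subtype.val_injective.image_injective
  have hval : ∀ a : {x // x ∉ coveredPoints U},
      Subtype.val '' {x | ρ.SameCycle a x} = {x | π.SameCycle a x} := by
    intro a
    ext x
    constructor
    · rintro ⟨y, hy, rfl⟩
      exact sameCycle_subtypePerm.1 hy
    · intro hx
      have hmem : x ∉ coveredPoints U := by
        refine (SameCycle.induction_on
          (r := fun x y => x ∉ coveredPoints U ↔ y ∉ coveredPoints U)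
          ⟨fun _ => Iff.rfl, fun h => h.symm, fun h h' => h.trans h'⟩ ?_ hx).1 a.2
        exact fun y => (apply_notMem_coveredPoints_iff hU y).symm
      exact ⟨⟨x, hmem⟩, sameCycle_subtypePerm.2 hx, rfl⟩
  rw [numCycles_eq_ncard_orbitSet, ← hinj.ncard_image,
    ← Set.ncard_image_of_injective _ hinj', ← Set.ncard_union_eq _ (Set.toFinite _) (Set.toFinite _)]
  · congr 1
    ext s
    constructor
    · rintro ⟨a, rfl⟩
      by_cases ha : a ∈ coveredPoints U
      · obtain ⟨c, hc, hac⟩ := ha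
        refine Or.inl ⟨c, hc, ?_⟩
        obtain ⟨⟨b, hb⟩, -⟩ := hU hc
        have hba := (hb a).1 hac
        ext x
        simp only [Finset.mem_coe, hb, Set.mem_ofPred_eq]
        exact ⟨fun h => hba.symm.trans h, fun h => hba.trans h⟩
      · exact Or.inr ⟨_, ⟨⟨a, ha⟩, rfl⟩, hval ⟨a, ha⟩⟩
    · rintro (⟨c, hc, rfl⟩ | ⟨_, ⟨a, rfl⟩, rfl⟩)
      · obtain ⟨⟨b, hb⟩, -⟩ := hU hc
        exact ⟨b, by ext x; simp [hb]⟩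
      · exact ⟨a, (hval a).symm⟩
  · rw [Set.disjoint_left]
    rintro _ ⟨c, hc, rfl⟩ ⟨s, -, hs⟩
    obtain ⟨x, hx⟩ := nonempty_of_mem_cycleSet (hU hc)
    have hx' : x ∈ (Subtype.val '' s : Set (Fin n)) := by
      rw [show (Subtype.val '' s : Set (Fin n)) = (c.1 : Set (Fin n)) from hs]
      exact hx
    obtain ⟨y, -, rfl⟩ := hx'
    exact y.2 ⟨c, hc, hx⟩

end Equiv.Perm

open Equiv Equiv.Perm

theorem ncard_setOf_ncard_orbitSet_eq {α : Type*} {m j : ℕ} (e : α ≃ Fin m) :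
    {σ : Perm α | σ.orbitSet.ncard = j}.ncard = stirlingFirst m j := by
  rw [stirlingFirst, ← Nat.card_coe_set_eq]
  refine Nat.card_congr (e.permCongr.subtypeEquiv fun σ => ?_)
  rw [numCycles_eq_ncard_orbitSet, Set.mem_ofPred_eq,
    ← ncard_orbitSet_eq_of_surjective (p := e.symm) e.symm.surjective fun z w => ?_]
  have h : e.permCongr σ = (e.symm.trans σ).trans e := rfl
  refine ⟨SameCycle.induction_on (r := fun z w => σ.SameCycle (e.symm z) (e.symm w))
      ⟨fun _ => SameCycle.refl _ _, fun h => h.symm, fun h h' => h.trans h'⟩ ?_, fun hs => ?_⟩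
  · intro x
    simp [sameCycle_apply_right, SameCycle.refl]
  · have := SameCycle.induction_on
      (r := fun x y => (e.permCongr σ).SameCycle (e x) (e y))
      ⟨fun _ => SameCycle.refl _ _, fun h => h.symm, fun h h' => h.trans h'⟩ ?_ hs
    · simpa using this
    · intro x
      have hx : e (σ x) = e.permCongr σ (e x) := by simp
      rw [hx]
      exact sameCycle_apply_right.2 (SameCycle.refl _ _)

theorem stirlingFirst_le_succ (m : ℕ) {j : ℕ} (hj : 0 < j) :
    stirlingFirst m j ≤ stirlingFirst (m + 1) j := by
  rw [← ncard_setOf_ncard_orbitSet_eq (Equiv.refl (Fin m)),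
    ← ncard_setOf_ncard_orbitSet_eq (finSuccEquiv m).symm]
  rcases m with _ | m
  · have h : {σ : Perm (Fin 0) | σ.orbitSet.ncard = j} = ∅ := by
      ext σ
      have h0 : σ.orbitSet = ∅ := Set.range_eq_empty _
      simp [h0, hj.ne]
    simp [h]
  · exact Set.ncard_le_ncard_of_injOn (insertAfter 0)
      (fun σ hσ => (ncard_orbitSet_insertAfter 0 σ).trans hσ)
      (insertAfter_injective 0).injOn (Set.toFinite _)

theorem stirlingFirst_mono {m m' : ℕ} (h : m ≤ m') {j : ℕ} (hj : 0 < j) :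
    stirlingFirst m j ≤ stirlingFirst m' j :=
  monotone_nat_of_le_succ (f := fun m => stirlingFirst m j)
    (fun m => stirlingFirst_le_succ m hj) h

theorem ncard_setOf_subset_cycleSet_le {n k : ℕ} {U : Set (Finset (Fin n) × (Fin n → Fin n))}
    (hU : U.ncard < k) :
    {π : Perm (Fin n) | π.numCycles = k ∧ U ⊆ π.cycleSet}.ncard ≤
      stirlingFirst (n - U.ncard) (k - U.ncard) := by
  classical
  rcases Set.eq_empty_or_nonempty {π : Perm (Fin n) | π.numCycles = k ∧ U ⊆ π.cycleSet} with
    h | ⟨π₁, -, hπ₁⟩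
  · simp [h]
  have hcard : Nat.card {x // x ∉ coveredPoints U} ≤ n - U.ncard := by
    have h1 := Set.ncard_add_ncard_compl (coveredPoints U)
    have h2 := ncard_le_ncard_coveredPoints hπ₁
    have h3 : Nat.card {x // x ∉ coveredPoints U} = (coveredPoints U)ᶜ.ncard :=
      Nat.card_coe_set_eq _
    rw [Nat.card_fin] at h1
    omega
  refine le_trans ?_ (stirlingFirst_mono hcard (by omega))
  rw [← ncard_setOf_ncard_orbitSet_eq (Finite.equivFin {x // x ∉ coveredPoints U})]
  refine Set.ncard_le_ncard_of_injOn
    (fun π => if h : U ⊆ π.cycleSet then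
      π.subtypePerm (p := (· ∉ coveredPoints U)) (apply_notMem_coveredPoints_iff h) else 1)
    ?_ ?_ (Set.toFinite _)
  · rintro π ⟨rfl, h⟩
    have := numCycles_eq_add_ncard_orbitSet_subtypePerm h
    simp only [h, dite_true, Set.mem_ofPred_eq]
    omega
  · rintro π ⟨-, h⟩ π' ⟨-, h'⟩ heq
    simp only [h, h', dite_true] at heq
    ext1 x
    by_cases hx : x ∈ coveredPoints U
    · obtain ⟨c, hc, hxc⟩ := hx
      have e := congrFun (h hc).2 x
      have e' := congrFun (h' hc).2 x
      simp only [hxc, if_true] at e e'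
      exact e.symm.trans e'
    · exact congrArg Subtype.val (DFunLike.congr_fun heq ⟨x, hx⟩)

theorem ncard_biUnion_le_mul {ι α : Type*} [Finite α] {s : Set ι} (hs : s.Finite) (f : ι → Set α)
    {m : ℕ} (h : ∀ i ∈ s, (f i).ncard ≤ m) : (⋃ i ∈ s, f i).ncard ≤ s.ncard * m := by
  classical
  lift s to Finset ι using hs
  refine (Finset.set_ncard_biUnion_le s f).trans ?_
  rw [Set.ncard_coe_finset, ← smul_eq_mul]
  exact Finset.sum_le_card_nsmul _ _ _ h

theorem ncard_setOf_subset_cycleSet_le_of_independent {n k t : ℕ} (hkt : t + 2 ≤ k)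
    {A : Set (Perm (Fin n))} (hA : ∀ π ∈ A, π.numCycles = k)
    {T : Set (Finset (Fin n) × (Fin n → Fin n))} (hT : T.ncard = t)
    (hindep : ∀ B ⊆ {π ∈ A | T ⊆ π.cycleSet},
      (∀ π₁ ∈ B, ∀ π₂ ∈ B, π₁ ≠ π₂ → π₁.cycleSet ∩ π₂.cycleSet = T) → B.ncard ≤ k) :
    {π ∈ A | T ⊆ π.cycleSet}.ncard ≤ k ^ 2 * stirlingFirst (n - t - 1) (k - t - 1) := by
  obtain ⟨B, ⟨hBA, hB⟩, hmax⟩ := (Set.toFinite {B : Set (Perm (Fin n)) |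
    B ⊆ {π ∈ A | T ⊆ π.cycleSet} ∧
      ∀ π₁ ∈ B, ∀ π₂ ∈ B, π₁ ≠ π₂ → π₁.cycleSet ∩ π₂.cycleSet = T}).exists_maximal
    ⟨∅, by simp⟩
  have hcover : {π ∈ A | T ⊆ π.cycleSet} ⊆ ⋃ b ∈ B, ⋃ c ∈ b.cycleSet \ T,
      {π | π.numCycles = k ∧ insert c T ⊆ π.cycleSet} := by
    rintro π ⟨hπA, hπT⟩
    suffices h : ∃ b ∈ B, ∃ c ∈ b.cycleSet \ T, c ∈ π.cycleSet by
      obtain ⟨b, hb, c, hc, hcπ⟩ := h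
      simp only [Set.mem_iUnion]
      exact ⟨b, hb, c, hc, hA π hπA, Set.insert_subset hcπ hπT⟩
    by_cases hπB : π ∈ B
    · have hlt : T.ncard < π.cycleSet.ncard := by
        have := hA π hπA
        rw [numCycles] at this
        omega
      obtain ⟨c, hc, hcT⟩ := Set.exists_mem_notMem_of_ncard_lt_ncard hlt (Set.toFinite T)
      exact ⟨π, hπB, c, ⟨hc, hcT⟩, hc⟩
    · by_contra! hno
      have hshare : ∀ b ∈ B, b.cycleSet ∩ π.cycleSet = T := by
        intro b hb
        refine Set.Subset.antisymm ?_ (Set.subset_inter (hBA hb).2 hπT)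
        rintro c ⟨hcb, hcπ⟩
        by_contra hcT
        exact hno b hb c ⟨hcb, hcT⟩ hcπ
      refine hπB (hmax (y := insert π B) ⟨Set.insert_subset ⟨hπA, hπT⟩ hBA, ?_⟩
        (Set.subset_insert _ _) (Set.mem_insert _ _))
      rintro π₁ (rfl | h₁) π₂ (rfl | h₂) hne
      · exact absurd rfl hne
      · rw [Set.inter_comm]
        exact hshare _ h₂
      · exact hshare _ h₁
      · exact hB _ h₁ _ h₂ hne
  have hcount : ∀ b ∈ B, (⋃ c ∈ b.cycleSet \ T,
      {π : Perm (Fin n) | π.numCycles = k ∧ insert c T ⊆ π.cycleSet}).ncard ≤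
        k * stirlingFirst (n - t - 1) (k - t - 1) := by
    intro b hb
    refine (ncard_biUnion_le_mul (m := stirlingFirst (n - t - 1) (k - t - 1))
      (Set.toFinite _) _ fun c hc => ?_).trans (Nat.mul_le_mul_right _ ?_)
    · have hins : (insert c T).ncard = t + 1 := by
        rw [Set.ncard_insert_of_notMem hc.2 (Set.toFinite T), hT]
      have := ncard_setOf_subset_cycleSet_le (U := insert c T) (k := k) (by omega)
      rwa [hins, ← Nat.sub_sub, ← Nat.sub_sub] at this
    · exact (Set.ncard_le_ncard Set.sdiff_subset (Set.toFinite _)).trans (hA b (hBA hb).1).le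
  calc {π ∈ A | T ⊆ π.cycleSet}.ncard
      ≤ _ := Set.ncard_le_ncard hcover (Set.toFinite _)
    _ ≤ B.ncard * (k * stirlingFirst (n - t - 1) (k - t - 1)) :=
      ncard_biUnion_le_mul (Set.toFinite B) _ hcount
    _ ≤ k * (k * stirlingFirst (n - t - 1) (k - t - 1)) :=
      Nat.mul_le_mul_right _ (hindep B hBA hB)
    _ = k ^ 2 * stirlingFirst (n - t - 1) (k - t - 1) := by ring

/-- If `k ≥ t + 2`, `A ⊆ S_{n,k}` is `t`-intersecting, `π₀ ∈ A`, and for every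
`t`-subset `T` of `M(π₀)` every subset of `A(T)` whose members pairwise share
exactly the cycles of `T` has size at most `k`, then
`|A| ≤ k²·C(k,t)·[n-t-1, k-t-1]`. -/
theorem stmt11 (n k t : ℕ) (ht : 0 < t) (hkt : t + 2 ≤ k)
    (A : Set (Equiv.Perm (Fin n)))
    (hA : ∀ π ∈ A, π.numCycles = k)
    (hInt : ∀ π₁ ∈ A, ∀ π₂ ∈ A, t ≤ (π₁.cycleSet ∩ π₂.cycleSet).ncard)
    (π₀ : Equiv.Perm (Fin n)) (hπ₀ : π₀ ∈ A)
    (hindep : ∀ T ⊆ π₀.cycleSet, T.ncard = t →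
      ∀ B ⊆ {π ∈ A | T ⊆ π.cycleSet},
        (∀ π₁ ∈ B, ∀ π₂ ∈ B, π₁ ≠ π₂ → π₁.cycleSet ∩ π₂.cycleSet = T) →
        B.ncard ≤ k) :
    A.ncard ≤ k ^ 2 * Nat.choose k t * stirlingFirst (n - t - 1) (k - t - 1) := by
  have hcover : A ⊆ ⋃ T ∈ {T | T ⊆ π₀.cycleSet ∧ T.ncard = t}, {π ∈ A | T ⊆ π.cycleSet} := by
    intro π hπ
    obtain ⟨T, hT, hTt⟩ := Set.exists_subset_card_eq (hInt π hπ π₀ hπ₀)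
    simp only [Set.mem_iUnion]
    exact ⟨T, ⟨hT.trans Set.inter_subset_right, hTt⟩, hπ, hT.trans Set.inter_subset_left⟩
  have hcard : {T | T ⊆ π₀.cycleSet ∧ T.ncard = t}.ncard = k.choose t := by
    rw [← hA π₀ hπ₀, numCycles]
    exact Set.ncard_powerset_ncard (Set.toFinite _) _
  calc A.ncard ≤ _ := Set.ncard_le_ncard hcover (Set.toFinite _)
    _ ≤ _ := ncard_biUnion_le_mul (Set.toFinite _) _ fun T hT =>
      ncard_setOf_subset_cycleSet_le_of_independent hkt hA hT.2 (hindep T hT.1 hT.2)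
    _ = k ^ 2 * Nat.choose k t * stirlingFirst (n - t - 1) (k - t - 1) := by
      rw [hcard]
      ring
end
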